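/- Let σ ≤ 0, d > 0, and θ be fixed real numbers, fix α ∈ (0,1] and constants C_2 > C_1 > 1, let c > 0 depend on d, θ, and set H = c·(log(MN))^{1+α}. Then for all positive integers M, N with C_1·N ≤ M ≤ C_2·N and every integer X with 2 ≤ X ≤ min(M, N): |Σ_{m=1}^M (1/m^{1−σ}) Σ_{h ∈ ℤ, |h| ≤ H} ∫_1^X e^{2πi(F_m(u) − hu)}/u^{1/2} du| ≤ C·X^{1/2}·(log X)^{2/3}·log H if σ = 0, and ≤ C·X^{1/2}·log H if σ < 0, where C depends only on α, σ, d, θ, C_1, C_2, c. -/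

import Mathlib

/-- `Fm d θ m u = d·u·log(e·m/(d·u)) + θ·u`. -/
noncomputable def Fm (d θ : ℝ) (m : ℕ) (u : ℝ) : ℝ :=
  d * u * Real.log (Real.exp 1 * m / (d * u)) + θ * u


noncomputable def Dk (K : ℕ) (u : ℝ) : ℂ :=
  ∑ h ∈ Finset.Icc (-(K : ℤ)) K, Complex.exp (((-(2 * Real.pi * h * u) : ℝ) : ℂ) * Complex.I)

lemma Dk_cont (K : ℕ) : Continuous (Dk K) := by
  unfold Dk; fun_prop

lemma Dk_tel (K : ℕ) (u : ℝ) :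
    Dk K u * (Complex.exp (Complex.I * ((-(2 * Real.pi * u) : ℝ) : ℂ)) - 1) =
      Complex.exp (((-(2 * Real.pi * (K + 1) * u) : ℝ) : ℂ) * Complex.I)
        - Complex.exp ((((2 * Real.pi * K * u) : ℝ) : ℂ) * Complex.I) := by
  induction K with
  | zero =>
    simp [Dk]
    ring_nf
  | succ K ih =>
    have hI : Finset.Icc (-((K + 1 : ℕ) : ℤ)) ((K + 1 : ℕ) : ℤ) =
        insert ((K : ℤ) + 1) (insert (-((K : ℤ) + 1)) (Finset.Icc (-(K : ℤ)) K)) := by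
      ext x; simp only [Finset.mem_Icc, Finset.mem_insert]; push_cast; omega
    have hD : Dk (K + 1) u = Complex.exp (((-(2 * Real.pi * (K + 1) * u) : ℝ) : ℂ) * Complex.I)
        + (Complex.exp ((((2 * Real.pi * (K + 1) * u) : ℝ) : ℂ) * Complex.I) + Dk K u) := by
      unfold Dk
      rw [hI, Finset.sum_insert, Finset.sum_insert]
      · push_cast
        ring_nf
      · simp
      · simp only [Finset.mem_Icc, Finset.mem_insert]; omega
    rw [hD, add_mul, add_mul, ih, mul_sub, mul_sub, ← Complex.exp_add, ← Complex.exp_add]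
    push_cast
    ring_nf

lemma Dk_sin (K : ℕ) (u : ℝ) : ‖Dk K u‖ * |Real.sin (Real.pi * u)| ≤ 1 := by
  have h := congrArg norm (Dk_tel K u)
  rw [norm_mul, Complex.norm_exp_I_mul_ofReal_sub_one] at h
  have h2 := norm_sub_le (Complex.exp (((-(2 * Real.pi * (K + 1) * u) : ℝ) : ℂ) * Complex.I))
    (Complex.exp ((((2 * Real.pi * K * u) : ℝ) : ℂ) * Complex.I))
  rw [Complex.norm_exp_ofReal_mul_I, Complex.norm_exp_ofReal_mul_I] at h2
  have h3 : ‖2 * Real.sin (-(2 * Real.pi * u) / 2)‖ = 2 * |Real.sin (Real.pi * u)| := by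
    rw [show -(2 * Real.pi * u) / 2 = -(Real.pi * u) by ring, Real.sin_neg]
    simp
  rw [h3] at h
  linarith

lemma Dk_triv (K : ℕ) (u : ℝ) : ‖Dk K u‖ ≤ 2 * K + 1 := by
  unfold Dk
  refine (norm_sum_le _ _).trans ?_
  simp only [Complex.norm_exp_ofReal_mul_I]
  simp
  have : ((K : ℤ) + 1 + K).toNat = 2 * K + 1 := by omega
  rw [this]; push_cast; rfl

lemma Dk_bound (K n : ℕ) (u : ℝ) (h1 : (n : ℝ) ≤ u) (h2 : u ≤ n + 1) :
    ‖Dk K u‖ ≤ 2 / (1 / (2 * K + 1) + 2 * (u - n)) + 2 / (1 / (2 * K + 1) + 2 * (n + 1 - u)) := by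
  have hq : (0 : ℝ) < 2 * K + 1 := by positivity
  have ht := Dk_triv K u
  have hs := Dk_sin K u
  have hsin : |Real.sin (Real.pi * u)| = |Real.sin (Real.pi * (u - n))| := by
    rw [show Real.pi * (u - n) = Real.pi * u - n * Real.pi by ring, Real.sin_sub_nat_mul_pi]
    simp [abs_mul]
  have key : ∀ w : ℝ, 0 ≤ w → ‖Dk K u‖ * (2 * w) ≤ 1 → ‖Dk K u‖ ≤ 2 / (1 / (2 * K + 1) + 2 * w) := by
    intro w hw h
    have : 0 < 1 / (2 * (K:ℝ) + 1) + 2 * w := by positivity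
    rw [le_div_iff₀ this, mul_add]
    have : ‖Dk K u‖ * (1 / (2 * K + 1)) ≤ 1 := by
      rw [mul_one_div, div_le_one hq]; exact ht
    linarith
  have hpi := Real.pi_pos
  have sinb : ∀ w : ℝ, 0 ≤ w → w ≤ 1 / 2 → 2 * w ≤ |Real.sin (Real.pi * w)| := by
    intro w hw hw'
    have := Real.mul_le_sin (x := Real.pi * w) (by positivity) (by nlinarith)
    have e : 2 / Real.pi * (Real.pi * w) = 2 * w := by field_simp
    rw [e] at this
    exact this.trans (le_abs_self _)
  rcases le_total (u - n) (1/2) with h | h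
  · have := key (u - n) (by linarith) (by
      refine le_trans ?_ hs
      rw [hsin]
      exact mul_le_mul_of_nonneg_left (sinb _ (by linarith) h) (norm_nonneg _))
    have h0 : 0 ≤ 2 / (1 / (2 * (K:ℝ) + 1) + 2 * (n + 1 - u)) := by
      have : 0 ≤ n + 1 - u := by linarith
      positivity
    linarith
  · have := key (n + 1 - u) (by linarith) (by
      refine le_trans ?_ hs
      rw [hsin]
      refine mul_le_mul_of_nonneg_left ?_ (norm_nonneg _)
      have := sinb (n + 1 - u) (by linarith) (by linarith)
      rwa [show Real.pi * (n + 1 - u) = Real.pi - Real.pi * (u - n) by ring, Real.sin_pi_sub] at this)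
    have h0 : 0 ≤ 2 / (1 / (2 * (K:ℝ) + 1) + 2 * (u - n)) := by
      have : 0 ≤ u - n := by linarith
      positivity
    linarith

lemma Dk_int (K n : ℕ) : ∫ u in (n : ℝ)..(n + 1), ‖Dk K u‖ ≤ 2 * Real.log (4 * K + 3) := by
  have hq : (0 : ℝ) < 1 / (2 * K + 1) := by positivity
  set q : ℝ := 1 / (2 * K + 1) with hqd
  have hle : (n : ℝ) ≤ n + 1 := by linarith
  have hd1 : ∀ u ∈ Set.uIcc (n : ℝ) (n + 1),
      HasDerivAt (fun u : ℝ => Real.log (q + 2 * (u - n)) - Real.log (q + 2 * (n + 1 - u)))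
        (2 / (q + 2 * (u - n)) + 2 / (q + 2 * (n + 1 - u))) u := by
    intro u hu
    rw [Set.uIcc_of_le hle] at hu
    obtain ⟨ha, hb⟩ := hu
    have e1 : HasDerivAt (fun u : ℝ => q + 2 * (u - n)) 2 u := by
      simpa using (((hasDerivAt_id u).sub_const (n:ℝ)).const_mul 2).const_add q
    have e2 : HasDerivAt (fun u : ℝ => q + 2 * (n + 1 - u)) (-2) u := by
      simpa using (((hasDerivAt_id u).const_sub ((n:ℝ) + 1)).const_mul 2).const_add q
    have := (e1.log (by linarith)).sub (e2.log (by linarith))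
    refine this.congr_deriv ?_
    rw [neg_div, sub_neg_eq_add]
  have hc : ContinuousOn (fun u : ℝ => 2 / (q + 2 * (u - n)) + 2 / (q + 2 * (n + 1 - u)))
      (Set.uIcc (n : ℝ) (n + 1)) := by
    rw [Set.uIcc_of_le hle]
    refine ContinuousOn.add ?_ ?_
    · refine ContinuousOn.div (by fun_prop) (by fun_prop) ?_
      intro u hu; have := hu.1; exact (by linarith : 0 < q + 2 * (u - n)).ne'
    · refine ContinuousOn.div (by fun_prop) (by fun_prop) ?_
      intro u hu; have := hu.2; exact (by linarith : 0 < q + 2 * (n + 1 - u)).ne'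
  have := intervalIntegral.integral_eq_sub_of_hasDerivAt hd1 hc.intervalIntegrable
  calc ∫ u in (n : ℝ)..(n + 1), ‖Dk K u‖ ≤
      ∫ u in (n : ℝ)..(n + 1), (2 / (q + 2 * (u - n)) + 2 / (q + 2 * (n + 1 - u))) := by
        refine intervalIntegral.integral_mono_on hle
          ((Dk_cont K).norm.intervalIntegrable _ _) hc.intervalIntegrable ?_
        intro u hu
        exact Dk_bound K n u hu.1 hu.2
    _ = 2 * (Real.log (q + 2) - Real.log q) := by
        rw [this]; ring_nf
    _ = 2 * Real.log (4 * K + 3) := by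
        rw [← Real.log_div (by positivity) (by positivity)]
        congr 2
        rw [hqd]; field_simp; ring

lemma sup_bound (f f' : ℝ → ℂ) (hf : ∀ x, HasDerivAt f (f' x) x) (hf' : Continuous f') (a u : ℝ)
    (h1 : a ≤ u) (h2 : u ≤ a + 1) : ‖f u‖ ≤ ∫ v in a..(a + 1), (‖f v‖ + ‖f' v‖) := by
  have hfc : Continuous f := continuous_iff_continuousAt.2 fun x => (hf x).continuousAt
  have hle : a ≤ a + 1 := by linarith
  have key : ∀ v ∈ Set.Icc a (a + 1), ‖f u‖ ≤ ‖f v‖ + ∫ w in a..(a + 1), ‖f' w‖ := by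
    intro v hv
    have e := intervalIntegral.integral_eq_sub_of_hasDerivAt (a := v) (b := u) (fun x _ => hf x)
      (hf'.intervalIntegrable _ _)
    have : ‖∫ w in v..u, f' w‖ ≤ ∫ w in a..(a + 1), ‖f' w‖ := by
      refine (intervalIntegral.norm_integral_le_abs_integral_norm).trans ?_
      refine (intervalIntegral.abs_integral_mono_interval (c := a) (d := a + 1) ?_ ?_ ?_).trans ?_
      · refine Set.uIoc_subset_uIoc_of_uIcc_subset_uIcc (Set.uIcc_subset_uIcc ?_ ?_) <;>
          rw [Set.uIcc_of_le hle]
        · exact hv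
        · exact ⟨h1, h2⟩
      · filter_upwards with x using norm_nonneg _
      · exact hf'.norm.intervalIntegrable _ _
      · rw [abs_of_nonneg]
        exact intervalIntegral.integral_nonneg hle fun _ _ => norm_nonneg _
    rw [e] at this
    have := norm_sub_norm_le (f u) (f v)
    linarith
  have := intervalIntegral.integral_mono_on (μ := MeasureTheory.volume) hle (f := fun _ => ‖f u‖)
    (g := fun v => ‖f v‖ + ∫ w in a..(a + 1), ‖f' w‖) (continuous_const.intervalIntegrable _ _)
    ((hfc.norm.add continuous_const).intervalIntegrable _ _) key
  rw [intervalIntegral.integral_add (hfc.norm.intervalIntegrable _ _) (continuous_const.intervalIntegrable _ _)] at this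
  rw [intervalIntegral.integral_add (hfc.norm.intervalIntegrable _ _) (hf'.norm.intervalIntegrable _ _)]
  simpa using this

lemma osc (β : ℝ) (hβ : β ≠ 0) (X : ℝ) (hX : 1 ≤ X) :
    ‖∫ u in (1:ℝ)..X, Complex.exp (((β * u : ℝ) : ℂ) * Complex.I) / ((Real.sqrt u : ℝ) : ℂ)‖ ≤ 2 / |β| := by
  have hpos : ∀ u ∈ Set.uIcc 1 X, 0 < u := by
    intro u hu; rw [Set.uIcc_of_le hX] at hu; linarith [hu.1]
  have hβc : (β : ℂ) ≠ 0 := by exact_mod_cast hβ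
  have hdi : ∀ u ∈ Set.uIcc 1 X, HasDerivAt (fun u : ℝ => (Real.sqrt u)⁻¹) (-(1 / (2 * u * Real.sqrt u))) u := by
    intro u hu
    have h0 := hpos u hu
    have hs := Real.sqrt_pos.2 h0
    refine ((Real.hasDerivAt_sqrt h0.ne').inv hs.ne').congr_deriv ?_
    rw [Real.sq_sqrt h0.le]
    field_simp
  have hde : ∀ u : ℝ, HasDerivAt (fun u : ℝ => Complex.exp (((β * u : ℝ) : ℂ) * Complex.I))
      (Complex.exp (((β * u : ℝ) : ℂ) * Complex.I) * (β * Complex.I)) u := by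
    intro u
    have : HasDerivAt (fun u : ℝ => ((β * u : ℝ) : ℂ) * Complex.I) (β * Complex.I) u := by
      have := (((hasDerivAt_id u).const_mul β).ofReal_comp).mul_const Complex.I
      simpa using this
    exact this.cexp
  have hE : ∀ u ∈ Set.uIcc 1 X, HasDerivAt (fun u : ℝ =>
      Complex.exp (((β * u : ℝ) : ℂ) * Complex.I) / (β * Complex.I) * (((Real.sqrt u)⁻¹ : ℝ) : ℂ))
      (Complex.exp (((β * u : ℝ) : ℂ) * Complex.I) / ((Real.sqrt u : ℝ) : ℂ) -
        Complex.exp (((β * u : ℝ) : ℂ) * Complex.I) / (β * Complex.I) * ((1 / (2 * u * Real.sqrt u) : ℝ) : ℂ)) u := by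
    intro u hu
    have := ((hde u).div_const (β * Complex.I)).mul (hdi u hu).ofReal_comp
    refine this.congr_deriv ?_
    have hne : (β : ℂ) * Complex.I ≠ 0 := mul_ne_zero hβc Complex.I_ne_zero
    rw [mul_div_assoc, div_self hne]
    push_cast
    ring
  have hcs : ContinuousOn (fun u : ℝ => Real.sqrt u) (Set.uIcc 1 X) := Real.continuous_sqrt.continuousOn
  have hsne : ∀ u ∈ Set.uIcc 1 X, Real.sqrt u ≠ 0 := fun u hu => (Real.sqrt_pos.2 (hpos u hu)).ne'
  have hc1 : ContinuousOn (fun u : ℝ => Complex.exp (((β * u : ℝ) : ℂ) * Complex.I) / ((Real.sqrt u : ℝ) : ℂ)) (Set.uIcc 1 X) := by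
    refine ContinuousOn.div (by fun_prop) (by fun_prop) ?_
    intro u hu; exact_mod_cast hsne u hu
  have hcr : ContinuousOn (fun u : ℝ => 1 / (2 * u * Real.sqrt u)) (Set.uIcc 1 X) := by
    refine ContinuousOn.div (by fun_prop) (by fun_prop) ?_
    intro u hu
    have := hpos u hu
    have := hsne u hu
    positivity
  have hc2 : ContinuousOn (fun u : ℝ => Complex.exp (((β * u : ℝ) : ℂ) * Complex.I) / (β * Complex.I) * ((1 / (2 * u * Real.sqrt u) : ℝ) : ℂ)) (Set.uIcc 1 X) := by
    refine ContinuousOn.mul (by fun_prop) ?_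
    exact Complex.continuous_ofReal.comp_continuousOn hcr
  have e1 := intervalIntegral.integral_eq_sub_of_hasDerivAt hE (hc1.sub hc2).intervalIntegrable
  rw [intervalIntegral.integral_sub hc1.intervalIntegrable hc2.intervalIntegrable] at e1
  have e2 := intervalIntegral.integral_eq_sub_of_hasDerivAt hdi hcr.neg.intervalIntegrable
  have b2 : ‖∫ u in (1:ℝ)..X, Complex.exp (((β * u : ℝ) : ℂ) * Complex.I) / (β * Complex.I) * ((1 / (2 * u * Real.sqrt u) : ℝ) : ℂ)‖
      ≤ 1 / |β| * (1 - (Real.sqrt X)⁻¹) := by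
    refine (intervalIntegral.norm_integral_le_integral_norm hX).trans ?_
    have : ∫ u in (1:ℝ)..X, ‖Complex.exp (((β * u : ℝ) : ℂ) * Complex.I) / (β * Complex.I) * ((1 / (2 * u * Real.sqrt u) : ℝ) : ℂ)‖
        = ∫ u in (1:ℝ)..X, (-(1 / |β|)) * (-(1 / (2 * u * Real.sqrt u))) := by
      refine intervalIntegral.integral_congr ?_
      intro u hu
      have h0 := hpos u hu
      simp only
      rw [norm_mul, norm_div, Complex.norm_exp_ofReal_mul_I, norm_mul, Complex.norm_I, Complex.norm_real, Complex.norm_real]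
      rw [Real.norm_eq_abs, Real.norm_of_nonneg (by positivity)]
      ring
    rw [this, intervalIntegral.integral_const_mul, e2]
    simp
    rw [← sub_nonneg]; ring_nf; rfl
  have n1 : ∀ x : ℝ, 0 < x → ‖Complex.exp (((β * x : ℝ) : ℂ) * Complex.I) / (β * Complex.I) * (((Real.sqrt x)⁻¹ : ℝ) : ℂ)‖ = 1 / |β| * (Real.sqrt x)⁻¹ := by
    intro x hx
    simp only [norm_mul, norm_div, Complex.norm_exp_ofReal_mul_I, Complex.norm_I, Complex.norm_real]
    rw [Real.norm_eq_abs, Real.norm_of_nonneg (by positivity)]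
    ring
  have e3 := sub_eq_iff_eq_add.1 e1
  rw [e3]
  refine (norm_add_le _ _).trans ?_
  refine (add_le_add (norm_sub_le _ _) b2).trans ?_
  rw [n1 X (by linarith), n1 1 one_pos]
  simp
  apply le_of_eq; ring

lemma int_sqrt (X : ℝ) (hX : 1 ≤ X) : ∫ u in (1:ℝ)..X, 1 / Real.sqrt u ≤ 2 * Real.sqrt X := by
  have hpos : ∀ u ∈ Set.uIcc 1 X, 0 < u := by
    intro u hu; rw [Set.uIcc_of_le hX] at hu; linarith [hu.1]
  have hd : ∀ u ∈ Set.uIcc 1 X, HasDerivAt (fun u : ℝ => 2 * Real.sqrt u) (1 / Real.sqrt u) u := by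
    intro u hu
    refine ((Real.hasDerivAt_sqrt (hpos u hu).ne').const_mul 2).congr_deriv ?_
    field_simp
  have hc : ContinuousOn (fun u : ℝ => 1 / Real.sqrt u) (Set.uIcc 1 X) := by
    refine ContinuousOn.div (by fun_prop) (by fun_prop) ?_
    intro u hu; exact (Real.sqrt_pos.2 (hpos u hu)).ne'
  rw [intervalIntegral.integral_eq_sub_of_hasDerivAt hd hc.intervalIntegrable]
  simp

lemma meansq (τ : ℝ) (hτ : 0 < τ) (X : ℝ) (hX : 1 ≤ X) (Y : ℕ) (a : ℕ → ℂ) :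
    ∫ u in (1:ℝ)..X, ‖∑ m ∈ Finset.Icc 1 Y, a m * Complex.exp (((τ * u * Real.log m : ℝ) : ℂ) * Complex.I)‖ ^ 2 / Real.sqrt u
      ≤ ∑ m ∈ Finset.Icc 1 Y, ∑ k ∈ Finset.Icc 1 Y, ‖a m‖ * ‖a k‖ *
        (if m = k then 2 * Real.sqrt X else 2 / (τ * |Real.log m - Real.log k|)) := by
  have hpos : ∀ u ∈ Set.uIcc 1 X, 0 < u := by
    intro u hu; rw [Set.uIcc_of_le hX] at hu; linarith [hu.1]
  have e : ((∫ u in (1:ℝ)..X, ‖∑ m ∈ Finset.Icc 1 Y, a m * Complex.exp (((τ * u * Real.log m : ℝ) : ℂ) * Complex.I)‖ ^ 2 / Real.sqrt u : ℝ) : ℂ)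
      = ∑ m ∈ Finset.Icc 1 Y, ∑ k ∈ Finset.Icc 1 Y, (a m * (starRingEnd ℂ) (a k)) *
        ∫ u in (1:ℝ)..X, Complex.exp (((τ * (Real.log m - Real.log k) * u : ℝ) : ℂ) * Complex.I) / ((Real.sqrt u : ℝ) : ℂ) := by
    rw [← intervalIntegral.integral_ofReal]
    have hci : ∀ m k : ℕ, IntervalIntegrable (fun u : ℝ => (a m * (starRingEnd ℂ) (a k)) *
        (Complex.exp (((τ * (Real.log m - Real.log k) * u : ℝ) : ℂ) * Complex.I) / ((Real.sqrt u : ℝ) : ℂ))) MeasureTheory.volume 1 X := by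
      intro m k
      refine ContinuousOn.intervalIntegrable (ContinuousOn.mul (by fun_prop) ?_)
      refine ContinuousOn.div (by fun_prop) (by fun_prop) ?_
      intro u hu; exact_mod_cast (Real.sqrt_pos.2 (hpos u hu)).ne'
    simp_rw [← intervalIntegral.integral_const_mul]
    rw [← show _ = _ from Finset.sum_congr rfl fun m _ => intervalIntegral.integral_finsetSum fun k _ => hci m k]
    rw [← intervalIntegral.integral_finsetSum]
    · refine intervalIntegral.integral_congr ?_
      intro u hu
      simp only
      rw [Complex.ofReal_div, Complex.ofReal_pow, ← Complex.mul_conj', map_sum, Finset.sum_mul_sum, Finset.sum_div]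
      refine Finset.sum_congr rfl fun m _ => ?_
      rw [Finset.sum_div]
      refine Finset.sum_congr rfl fun k _ => ?_
      rw [map_mul, ← Complex.exp_conj]
      simp only [map_mul, Complex.conj_I, Complex.conj_ofReal]
      rw [mul_mul_mul_comm, ← Complex.exp_add, mul_div_assoc]
      congr 3
      rw [show τ * (Real.log m - Real.log k) * u = τ * u * Real.log m - τ * u * Real.log k by ring,
        Complex.ofReal_sub]
      ring
    · intro m _
      have := IntervalIntegrable.sum (Finset.Icc 1 Y) (fun k _ => hci m k)
      simpa [Finset.sum_fn] using this
  have h0 : 0 ≤ ∫ u in (1:ℝ)..X, ‖∑ m ∈ Finset.Icc 1 Y, a m * Complex.exp (((τ * u * Real.log m : ℝ) : ℂ) * Complex.I)‖ ^ 2 / Real.sqrt u :=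
    intervalIntegral.integral_nonneg hX fun u _ => by positivity
  rw [← Real.norm_of_nonneg h0, ← Complex.norm_real, e]
  refine (norm_sum_le _ _).trans (Finset.sum_le_sum fun m hm => ?_)
  refine (norm_sum_le _ _).trans (Finset.sum_le_sum fun k hk => ?_)
  rw [norm_mul, norm_mul, RCLike.norm_conj]
  refine mul_le_mul_of_nonneg_left ?_ (by positivity)
  split_ifs with h
  · subst h
    refine (intervalIntegral.norm_integral_le_integral_norm hX).trans ?_
    refine le_trans (le_of_eq ?_) (int_sqrt X hX)
    refine intervalIntegral.integral_congr ?_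
    intro u hu
    simp only [norm_div, Complex.norm_exp_ofReal_mul_I, Complex.norm_real]
    rw [Real.norm_of_nonneg (by positivity)]
  · have hne : τ * (Real.log m - Real.log k) ≠ 0 := by
      refine mul_ne_zero hτ.ne' (sub_ne_zero.2 ?_)
      intro hl
      have hm1 := (Finset.mem_Icc.1 hm).1
      have hk1 := (Finset.mem_Icc.1 hk).1
      have := Real.log_injOn_pos (Set.mem_Ioi.2 (by exact_mod_cast hm1)) (Set.mem_Ioi.2 (by exact_mod_cast hk1)) hl
      exact h (by exact_mod_cast this)
    have := osc _ hne X hX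
    rwa [abs_mul, abs_of_pos hτ] at this

lemma hsum (Y : ℕ) : ∑ k ∈ Finset.range (Y + 1), (1 : ℝ) / k ≤ 1 + Real.log Y := by
  have h := harmonic_le_one_add_log Y
  rw [Finset.sum_range_succ']
  unfold harmonic at h
  push_cast at h
  simpa using h

lemma hsum_abs (Y m : ℕ) (hm : m ∈ Finset.Icc 1 Y) :
    ∑ k ∈ Finset.Icc 1 Y, (1 : ℝ) / |(m : ℝ) - k| ≤ 2 * (1 + Real.log Y) := by
  have hg : ∀ (s : Finset ℕ) (φ : ℕ → ℕ), Set.InjOn φ s → (∀ k ∈ s, φ k ≤ Y) →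
      ∑ k ∈ s, (1 : ℝ) / (φ k : ℕ) ≤ 1 + Real.log Y := by
    intro s φ hi hb
    refine le_trans ?_ (hsum Y)
    rw [← Finset.sum_image (f := fun k : ℕ => (1 : ℝ) / k) hi]
    refine Finset.sum_le_sum_of_subset_of_nonneg ?_ fun _ _ _ => by positivity
    intro x hx
    obtain ⟨k, hk, rfl⟩ := Finset.mem_image.1 hx
    exact Finset.mem_range.2 (Nat.lt_succ_of_le (hb k hk))
  rw [Finset.mem_Icc] at hm
  rw [← Finset.sum_filter_add_sum_filter_not _ (fun k => k < m), two_mul]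
  refine add_le_add ?_ ?_
  · refine le_trans (le_of_eq ?_) (hg ((Finset.Icc 1 Y).filter fun k => k < m) (fun k => m - k) ?_ ?_)
    · refine Finset.sum_congr rfl fun k hk => ?_
      have hk' := (Finset.mem_filter.1 hk).2
      rw [Nat.cast_sub hk'.le, abs_of_nonneg]
      have : (k : ℝ) ≤ m := by exact_mod_cast hk'.le
      linarith
    · intro x hx y hy h
      simp at hx hy h
      omega
    · intro k hk; simp; omega
  · refine le_trans (le_of_eq ?_) (hg ((Finset.Icc 1 Y).filter fun k => ¬ k < m) (fun k => k - m) ?_ ?_)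
    · refine Finset.sum_congr rfl fun k hk => ?_
      have hk' := not_lt.1 (Finset.mem_filter.1 hk).2
      rw [Nat.cast_sub hk', abs_sub_comm, abs_of_nonneg]
      have : (m : ℝ) ≤ k := by exact_mod_cast hk'
      linarith
    · intro x hx y hy h
      simp at hx hy h
      omega
    · intro k hk
      simp at hk
      simp; omega

lemma log_diff_aux (m k : ℕ) (hm : 1 ≤ m) (hmk : m < k) :
    1 / ((m : ℝ) * k) * (1 / |Real.log m - Real.log k|) ≤ 1 / m * (1 / |(m : ℝ) - k|) := by
  have hm0 : (0 : ℝ) < m := by exact_mod_cast hm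
  have hmk' : (m : ℝ) < k := by exact_mod_cast hmk
  have hk0 : (0 : ℝ) < k := hm0.trans hmk'
  have hl : (k - m) / k ≤ Real.log k - Real.log m := by
    have := Real.one_sub_inv_le_log_of_pos (x := (k : ℝ) / m) (by positivity)
    rw [Real.log_div hk0.ne' hm0.ne'] at this
    refine le_trans (le_of_eq ?_) this
    field_simp
  have hp : 0 < ((k : ℝ) - m) / k := div_pos (by linarith) hk0
  rw [abs_sub_comm, abs_of_pos (lt_of_lt_of_le hp hl), abs_sub_comm, abs_of_pos (by linarith : (0:ℝ) < k - m)]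
  have : 1 / (Real.log k - Real.log m) ≤ 1 / (((k : ℝ) - m) / k) := one_div_le_one_div_of_le hp hl
  refine (mul_le_mul_of_nonneg_left this (by positivity)).trans (le_of_eq ?_)
  have : (k : ℝ) - m ≠ 0 := by linarith
  field_simp

lemma log_diff (m k : ℕ) (hm : 1 ≤ m) (hk : 1 ≤ k) :
    1 / ((m : ℝ) * k) * (1 / |Real.log m - Real.log k|) ≤
      1 / m * (1 / |(m : ℝ) - k|) + 1 / k * (1 / |(m : ℝ) - k|) := by
  rcases lt_trichotomy m k with h | h | h
  · have := log_diff_aux m k hm h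
    have : 0 ≤ 1 / (k : ℝ) * (1 / |(m : ℝ) - k|) := by positivity
    linarith
  · subst h; simp
  · have := log_diff_aux k m hk h
    rw [abs_sub_comm, abs_sub_comm (k : ℝ), mul_comm (k : ℝ)] at this
    have : 0 ≤ 1 / (m : ℝ) * (1 / |(m : ℝ) - k|) := by positivity
    linarith

lemma offdiag (Y : ℕ) : ∑ m ∈ Finset.Icc 1 Y, ∑ k ∈ Finset.Icc 1 Y,
    1 / ((m : ℝ) * k) * (1 / |Real.log m - Real.log k|) ≤ 4 * (1 + Real.log Y) ^ 2 := by
  have hlog : 0 ≤ 1 + Real.log Y := by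
    have := Real.log_natCast_nonneg Y; linarith
  have h1 : ∑ m ∈ Finset.Icc 1 Y, (1 : ℝ) / m ≤ 1 + Real.log Y := by
    refine le_trans ?_ (hsum Y)
    refine Finset.sum_le_sum_of_subset_of_nonneg ?_ fun _ _ _ => by positivity
    intro x hx; simp at hx ⊢; omega
  have hA : ∑ m ∈ Finset.Icc 1 Y, ∑ k ∈ Finset.Icc 1 Y, 1 / (m : ℝ) * (1 / |(m : ℝ) - k|)
      ≤ 2 * (1 + Real.log Y) ^ 2 := by
    calc _ ≤ ∑ m ∈ Finset.Icc 1 Y, 1 / (m : ℝ) * (2 * (1 + Real.log Y)) := by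
          refine Finset.sum_le_sum fun m hm => ?_
          rw [← Finset.mul_sum]
          exact mul_le_mul_of_nonneg_left (hsum_abs Y m hm) (by positivity)
      _ = (∑ m ∈ Finset.Icc 1 Y, 1 / (m : ℝ)) * (2 * (1 + Real.log Y)) := by rw [Finset.sum_mul]
      _ ≤ (1 + Real.log Y) * (2 * (1 + Real.log Y)) :=
          mul_le_mul_of_nonneg_right h1 (by positivity)
      _ = _ := by ring
  have hB : ∑ m ∈ Finset.Icc 1 Y, ∑ k ∈ Finset.Icc 1 Y, 1 / (k : ℝ) * (1 / |(m : ℝ) - k|)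
      ≤ 2 * (1 + Real.log Y) ^ 2 := by
    rw [Finset.sum_comm]
    simp_rw [abs_sub_comm]
    exact hA
  calc _ ≤ ∑ m ∈ Finset.Icc 1 Y, ∑ k ∈ Finset.Icc 1 Y,
        (1 / (m : ℝ) * (1 / |(m : ℝ) - k|) + 1 / k * (1 / |(m : ℝ) - k|)) :=
        Finset.sum_le_sum fun m hm => Finset.sum_le_sum fun k hk =>
          log_diff m k (Finset.mem_Icc.1 hm).1 (Finset.mem_Icc.1 hk).1
    _ ≤ _ := by
        simp_rw [Finset.sum_add_distrib]
        linarith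

lemma diag_bound : ∃ Z : ℝ, 0 ≤ Z ∧ ∀ Y : ℕ,
    ∑ m ∈ Finset.Icc 1 Y, ((1 + Real.log m) / m) ^ 2 ≤ Z := by
  have hs : Summable (fun n : ℕ => (n : ℝ) ^ (-(3/2) : ℝ)) := Real.summable_nat_rpow.2 (by norm_num)
  refine ⟨25 * ∑' n : ℕ, (n : ℝ) ^ (-(3/2) : ℝ), by positivity, fun Y => ?_⟩
  calc _ ≤ ∑ m ∈ Finset.Icc 1 Y, 25 * (m : ℝ) ^ (-(3/2) : ℝ) := by
        refine Finset.sum_le_sum fun m hm => ?_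
        have h1 : (1 : ℝ) ≤ m := by exact_mod_cast (Finset.mem_Icc.1 hm).1
        have h0 : (0 : ℝ) < m := by linarith
        have hl := Real.log_le_rpow_div h0.le (ε := 1/4) (by norm_num)
        have hr := Real.one_le_rpow h1 (z := 1/4) (by norm_num)
        have hl0 := Real.log_nonneg h1
        have : (1 + Real.log m) / m ≤ 5 * (m : ℝ) ^ (-(3/4) : ℝ) := by
          rw [div_le_iff₀ h0, mul_assoc, ← Real.rpow_add_one h0.ne']
          norm_num at *
          linarith
        refine (pow_le_pow_left₀ (by positivity) this 2).trans (le_of_eq ?_)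
        rw [mul_pow, ← Real.rpow_natCast, ← Real.rpow_natCast, ← Real.rpow_mul h0.le]
        norm_num
    _ = 25 * ∑ m ∈ Finset.Icc 1 Y, (m : ℝ) ^ (-(3/2) : ℝ) := by rw [Finset.mul_sum]
    _ ≤ _ := by
        refine mul_le_mul_of_nonneg_left ?_ (by norm_num)
        exact hs.sum_le_tsum _ fun _ _ => by positivity

lemma log_four (X : ℝ) (hX : 1 ≤ X) : (1 + Real.log X) ^ 4 ≤ 6561 * Real.sqrt X := by
  have h0 : 0 < X := by linarith
  have hl := Real.log_le_rpow_div h0.le (ε := 1/8) (by norm_num)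
  have hr := Real.one_le_rpow hX (z := 1/8) (by norm_num)
  have hl0 := Real.log_nonneg hX
  have : 1 + Real.log X ≤ 9 * X ^ (1/8 : ℝ) := by
    norm_num at *; linarith
  refine (pow_le_pow_left₀ (by positivity) this 4).trans (le_of_eq ?_)
  rw [mul_pow, ← Real.rpow_natCast (X ^ (1/8 : ℝ)), ← Real.rpow_mul h0.le, Real.sqrt_eq_rpow]
  norm_num

lemma meansq_final (τ : ℝ) (hτ : 0 < τ) (A : ℝ) (hA : 0 ≤ A) : ∃ Z : ℝ, 0 ≤ Z ∧
    ∀ X : ℕ, 1 ≤ X → ∀ a : ℕ → ℂ, (∀ m : ℕ, 1 ≤ m → ‖a m‖ ≤ A * ((1 + Real.log m) / m)) →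
    ∫ u in (1:ℝ)..X, ‖∑ m ∈ Finset.Icc 1 X, a m * Complex.exp (((τ * u * Real.log m : ℝ) : ℂ) * Complex.I)‖ ^ 2 / Real.sqrt u
      ≤ Z * Real.sqrt X := by
  obtain ⟨Z, hZ0, hZ⟩ := diag_bound
  refine ⟨A ^ 2 * (2 * Z + 8 * 6561 / τ), by positivity, ?_⟩
  intro X hX a ha
  have hX' : (1 : ℝ) ≤ X := by exact_mod_cast hX
  refine (meansq τ hτ X hX' X a).trans ?_
  have hL0 : 0 ≤ Real.log X := Real.log_nonneg hX'
  have step : ∀ m ∈ Finset.Icc 1 X, ∀ k ∈ Finset.Icc 1 X, ‖a m‖ * ‖a k‖ *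
        (if m = k then 2 * Real.sqrt X else 2 / (τ * |Real.log m - Real.log k|)) ≤
      (if m = k then A ^ 2 * ((1 + Real.log m) / m) ^ 2 * (2 * Real.sqrt X) else 0) +
      A ^ 2 * (1 + Real.log X) ^ 2 * (2 / τ) * (1 / ((m : ℝ) * k) * (1 / |Real.log m - Real.log k|)) := by
    intro m hm k hk
    obtain ⟨hm1, hm2⟩ := Finset.mem_Icc.1 hm
    obtain ⟨hk1, hk2⟩ := Finset.mem_Icc.1 hk
    split_ifs with h
    · subst h
      have : ‖a m‖ * ‖a m‖ ≤ (A * ((1 + Real.log m) / m)) * (A * ((1 + Real.log m) / m)) :=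
        mul_le_mul (ha m hm1) (ha m hm1) (norm_nonneg _) ((norm_nonneg _).trans (ha m hm1))
      have := mul_le_mul_of_nonneg_right this (show 0 ≤ 2 * Real.sqrt X by positivity)
      simp only [sub_self, abs_zero, div_zero, mul_zero, add_zero]
      refine this.trans (le_of_eq (by ring))
    · have b : ∀ j : ℕ, 1 ≤ j → j ≤ X → ‖a j‖ ≤ A * (1 + Real.log X) * (1 / j) := by
        intro j h1 h2
        have hj : (0 : ℝ) < j := by exact_mod_cast h1
        have hl : Real.log j ≤ Real.log X := Real.log_le_log hj (by exact_mod_cast h2)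
        refine (ha j h1).trans ?_
        rw [mul_assoc, mul_one_div]
        gcongr
      have := mul_le_mul (b m hm1 hm2) (b k hk1 hk2) (norm_nonneg _) (by positivity)
      have := mul_le_mul_of_nonneg_right this (show 0 ≤ 2 / (τ * |Real.log m - Real.log k|) by positivity)
      refine this.trans (le_of_eq ?_)
      rw [zero_add, one_div_mul_one_div_rev, show (2 : ℝ) / (τ * |Real.log m - Real.log k|) = 2 / τ * (1 / |Real.log m - Real.log k|) by
        rw [div_mul_div_comm, mul_one]]
      have hm0 : (m : ℝ) ≠ 0 := by positivity
      have hk0 : (k : ℝ) ≠ 0 := by positivity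
      generalize |Real.log m - Real.log k| = q
      simp only [one_div, mul_inv]
      ring
  refine (Finset.sum_le_sum fun m hm => Finset.sum_le_sum fun k hk => step m hm k hk).trans ?_
  simp_rw [Finset.sum_add_distrib]
  have e1 : ∑ m ∈ Finset.Icc 1 X, ∑ k ∈ Finset.Icc 1 X,
      (if m = k then A ^ 2 * ((1 + Real.log m) / m) ^ 2 * (2 * Real.sqrt X) else 0) ≤ A ^ 2 * Z * (2 * Real.sqrt X) := by
    have : ∑ m ∈ Finset.Icc 1 X, ∑ k ∈ Finset.Icc 1 X,
      (if m = k then A ^ 2 * ((1 + Real.log m) / m) ^ 2 * (2 * Real.sqrt X) else 0) =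
      ∑ m ∈ Finset.Icc 1 X, A ^ 2 * ((1 + Real.log m) / m) ^ 2 * (2 * Real.sqrt X) := by
      refine Finset.sum_congr rfl fun m hm => ?_
      rw [Finset.sum_ite_eq, if_pos hm]
    rw [this, ← Finset.sum_mul, ← Finset.mul_sum]
    have := hZ X
    gcongr
  have e2 : ∑ m ∈ Finset.Icc 1 X, ∑ k ∈ Finset.Icc 1 X, A ^ 2 * (1 + Real.log X) ^ 2 * (2 / τ) * (1 / ((m : ℝ) * k) * (1 / |Real.log m - Real.log k|))
      ≤ A ^ 2 * (8 * 6561 / τ) * Real.sqrt X := by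
    simp_rw [← Finset.mul_sum]
    calc _ ≤ A ^ 2 * (1 + Real.log X) ^ 2 * (2 / τ) * (4 * (1 + Real.log X) ^ 2) :=
          mul_le_mul_of_nonneg_left (offdiag X) (by positivity)
      _ = A ^ 2 * (8 / τ) * (1 + Real.log X) ^ 4 := by ring
      _ ≤ A ^ 2 * (8 / τ) * (6561 * Real.sqrt X) :=
          mul_le_mul_of_nonneg_left (log_four X hX') (by positivity)
      _ = _ := by ring
  refine (add_le_add e1 e2).trans (le_of_eq (by ring))

lemma weighted (K X : ℕ) (hX : 1 ≤ X) (S T T' : ℝ → ℂ) (hS : Continuous S)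
    (hT : ∀ x, HasDerivAt T (T' x) x) (hT' : Continuous T') (R : ℝ) (hR : 0 ≤ R)
    (hST : ∀ u : ℝ, 1 ≤ u → u ≤ X → ‖S u‖ ≤ R + ‖T u‖) :
    ∫ u in (1:ℝ)..X, ‖Dk K u‖ * (‖S u‖ / Real.sqrt u) ≤
      2 * (2 * Real.log (4 * K + 3)) * ∫ u in (1:ℝ)..X, (R + ‖T u‖ + ‖T' u‖) / Real.sqrt u := by
  have hTc : Continuous T := continuous_iff_continuousAt.2 fun x => (hT x).continuousAt
  have hci : ∀ (g : ℝ → ℝ) (_ : Continuous g) (n : ℕ), 1 ≤ n →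
      IntervalIntegrable (fun u => g u / Real.sqrt u) MeasureTheory.volume (n : ℝ) (n + 1) := by
    intro g hg n hn
    refine ContinuousOn.intervalIntegrable ?_
    refine ContinuousOn.div (by fun_prop) (by fun_prop) ?_
    intro u hu
    rw [Set.uIcc_of_le (by linarith)] at hu
    have : (1 : ℝ) ≤ n := by exact_mod_cast hn
    exact (Real.sqrt_pos.2 (by linarith [hu.1])).ne'
  have hcD : Continuous fun u => ‖Dk K u‖ * ‖S u‖ := (Dk_cont K).norm.mul hS.norm
  have hc2 : Continuous fun u => ‖T u‖ + ‖T' u‖ := by fun_prop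
  have hcT : Continuous fun u => R + ‖T u‖ + ‖T' u‖ := by fun_prop
  have s1 := intervalIntegral.sum_integral_adjacent_intervals_Ico (a := fun n : ℕ => (n : ℝ))
    (f := fun u => ‖Dk K u‖ * ‖S u‖ / Real.sqrt u) (μ := MeasureTheory.volume) hX
    (fun n hn => by push_cast; exact hci _ hcD n hn.1)
  have s2 := intervalIntegral.sum_integral_adjacent_intervals_Ico (a := fun n : ℕ => (n : ℝ))
    (f := fun u => (R + ‖T u‖ + ‖T' u‖) / Real.sqrt u) (μ := MeasureTheory.volume) hX
    (fun n hn => by push_cast; exact hci _ hcT n hn.1)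
  simp only [Nat.cast_one, Nat.cast_add] at s1 s2
  simp_rw [← mul_div_assoc]
  rw [← s1, ← s2, Finset.mul_sum]
  refine Finset.sum_le_sum fun n hn => ?_
  rw [Finset.mem_Ico] at hn
  have hn1 : (1 : ℝ) ≤ n := by exact_mod_cast hn.1
  have hnX : (n : ℝ) + 1 ≤ X := by exact_mod_cast hn.2
  have hle : (n : ℝ) ≤ n + 1 := by linarith
  have hB : 0 ≤ 2 * Real.log (4 * K + 3) := by
    have := Real.log_nonneg (x := 4 * (K:ℝ) + 3) (by linarith [Nat.cast_nonneg (α := ℝ) K])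
    linarith
  have hsn : 0 < Real.sqrt n := Real.sqrt_pos.2 (by linarith)
  set J := ∫ u in (n:ℝ)..(n + 1), (R + ‖T u‖ + ‖T' u‖) with hJ
  have hJ0 : 0 ≤ J := intervalIntegral.integral_nonneg hle fun u _ => by positivity
  have hSJ : ∀ u ∈ Set.Icc (n:ℝ) (n + 1), ‖S u‖ ≤ J := by
    intro u hu
    have h1 := hST u (by linarith [hu.1]) (by linarith [hu.2])
    have h2 := sup_bound T T' hT hT' n u hu.1 hu.2
    have : J = R + ∫ v in (n:ℝ)..(n + 1), (‖T v‖ + ‖T' v‖) := by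
      rw [hJ]
      simp_rw [add_assoc]
      rw [intervalIntegral.integral_add (continuous_const.intervalIntegrable _ _)
        (hc2.intervalIntegrable _ _)]
      simp
    linarith
  calc ∫ u in (n:ℝ)..(n + 1), ‖Dk K u‖ * ‖S u‖ / Real.sqrt u
      ≤ ∫ u in (n:ℝ)..(n + 1), (J / Real.sqrt n) * ‖Dk K u‖ := by
        refine intervalIntegral.integral_mono_on hle (hci _ hcD n hn.1)
          ((continuous_const.mul (Dk_cont K).norm).intervalIntegrable _ _) ?_
        intro u hu
        have := hSJ u hu
        have hs : Real.sqrt n ≤ Real.sqrt u := Real.sqrt_le_sqrt hu.1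
        calc _ ≤ ‖Dk K u‖ * J / Real.sqrt n := by gcongr
          _ = _ := by ring
    _ = (J / Real.sqrt n) * ∫ u in (n:ℝ)..(n + 1), ‖Dk K u‖ := by
        rw [intervalIntegral.integral_const_mul]
    _ ≤ (J / Real.sqrt n) * (2 * Real.log (4 * K + 3)) :=
        mul_le_mul_of_nonneg_left (Dk_int K n) (by positivity)
    _ = (2 * Real.log (4 * K + 3)) * (J / Real.sqrt n) := mul_comm _ _
    _ ≤ (2 * Real.log (4 * K + 3)) * (2 * ∫ u in (n:ℝ)..(n + 1), (R + ‖T u‖ + ‖T' u‖) / Real.sqrt u) := by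
        refine mul_le_mul_of_nonneg_left ?_ hB
        rw [hJ, ← intervalIntegral.integral_div, ← intervalIntegral.integral_const_mul]
        refine intervalIntegral.integral_mono_on hle ((hcT.div_const _).intervalIntegrable _ _)
          ((hci _ hcT n hn.1).const_mul 2) ?_
        intro u hu
        have hu0 : 0 < u := by linarith [hu.1]
        have hs : Real.sqrt u ≤ 2 * Real.sqrt n := by
          rw [Real.sqrt_le_left (by positivity), mul_pow, Real.sq_sqrt (by linarith)]
          linarith [hu.2]
        have hsu : 0 < Real.sqrt u := Real.sqrt_pos.2 hu0
        rw [← mul_div_assoc, div_le_div_iff₀ hsn hsu]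
        have : 0 ≤ R + ‖T u‖ + ‖T' u‖ := by positivity
        nlinarith
    _ = _ := by ring

lemma tail_step (t : ℝ) (ht : 0 < t) (m : ℕ) (hm : 1 ≤ m) :
    ‖1 / (m : ℂ) * Complex.exp (((t * Real.log m : ℝ) : ℂ) * Complex.I) -
      (Complex.exp (((t * Real.log ((m : ℝ) + 1) : ℝ) : ℂ) * Complex.I) / (t * Complex.I) -
        Complex.exp (((t * Real.log m : ℝ) : ℂ) * Complex.I) / (t * Complex.I))‖ ≤ (1 + t) / (m : ℝ) ^ 2 := by
  have hm1 : (1 : ℝ) ≤ m := by exact_mod_cast hm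
  have htc : (t : ℂ) * Complex.I ≠ 0 := mul_ne_zero (by exact_mod_cast ht.ne') Complex.I_ne_zero
  have hde : ∀ x ∈ Set.Icc (m : ℝ) (m + 1), HasDerivAt (fun x : ℝ => Complex.exp (((t * Real.log x : ℝ) : ℂ) * Complex.I))
      (Complex.exp (((t * Real.log x : ℝ) : ℂ) * Complex.I) * (((t * x⁻¹ : ℝ) : ℂ) * Complex.I)) x := by
    intro x hx
    have hx0 : x ≠ 0 := by linarith [hx.1]
    exact ((((Real.hasDerivAt_log hx0).const_mul t).ofReal_comp).mul_const Complex.I).cexp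
  set φ : ℝ → ℂ := fun x => ((x⁻¹ : ℝ) : ℂ) * Complex.exp (((t * Real.log x : ℝ) : ℂ) * Complex.I) with hφ
  have hdφ : ∀ x ∈ Set.Icc (m : ℝ) (m + 1), HasDerivAt φ
      (((-(x ^ 2)⁻¹ : ℝ) : ℂ) * Complex.exp (((t * Real.log x : ℝ) : ℂ) * Complex.I) +
        ((x⁻¹ : ℝ) : ℂ) * (Complex.exp (((t * Real.log x : ℝ) : ℂ) * Complex.I) * (((t * x⁻¹ : ℝ) : ℂ) * Complex.I))) x := by
    intro x hx
    have hx0 : x ≠ 0 := by linarith [hx.1]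
    exact ((hasDerivAt_inv hx0).ofReal_comp).mul (hde x hx)
  have b1 : ∀ x ∈ Set.Icc (m : ℝ) (m + 1), ‖φ x - φ m‖ ≤ (1 + t) / (m : ℝ) ^ 2 := by
    intro x hx
    have := Convex.norm_image_sub_le_of_norm_hasDerivWithin_le (C := (1 + t) / (m : ℝ) ^ 2)
      (fun x hx => (hdφ x hx).hasDerivWithinAt) ?_ (convex_Icc _ _)
      (Set.left_mem_Icc.2 (by linarith : (m : ℝ) ≤ m + 1)) hx
    · refine this.trans (mul_le_of_le_one_right (by positivity) ?_)
      rw [Real.norm_of_nonneg (by linarith [hx.1])]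
      linarith [hx.2]
    · intro y hy
      have hy0 : 0 < y := by linarith [hy.1]
      refine (norm_add_le _ _).trans ?_
      simp only [norm_mul, Complex.norm_exp_ofReal_mul_I, Complex.norm_I, Complex.norm_real, mul_one, one_mul]
      rw [norm_neg, Real.norm_of_nonneg (by positivity : 0 ≤ (y ^ 2)⁻¹), Real.norm_of_nonneg (by positivity : 0 ≤ y⁻¹),
        Real.norm_of_nonneg ht.le]
      have : (y ^ 2)⁻¹ + y⁻¹ * (t * y⁻¹) = (1 + t) / y ^ 2 := by field_simp
      rw [this]
      have := hy.1
      gcongr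
  set ψ : ℝ → ℂ := fun x => (x : ℂ) * φ m - Complex.exp (((t * Real.log x : ℝ) : ℂ) * Complex.I) / (t * Complex.I) with hψ
  have hdψ : ∀ x ∈ Set.Icc (m : ℝ) (m + 1), HasDerivAt ψ (φ m - φ x) x := by
    intro x hx
    have := ((hasDerivAt_id x).ofReal_comp.mul_const (φ m)).sub ((hde x hx).div_const (t * Complex.I))
    refine this.congr_deriv ?_
    simp only [hφ]
    push_cast
    have h1 : (t : ℂ) ≠ 0 := by exact_mod_cast ht.ne'
    have h2 := Complex.I_ne_zero
    field_simp
  have := Convex.norm_image_sub_le_of_norm_hasDerivWithin_le (C := (1 + t) / (m : ℝ) ^ 2)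
      (fun x hx => (hdψ x hx).hasDerivWithinAt) (fun x hx => by rw [norm_sub_rev]; exact b1 x hx) (convex_Icc _ _)
      (Set.left_mem_Icc.2 (by linarith : (m : ℝ) ≤ m + 1)) (Set.right_mem_Icc.2 (by linarith : (m : ℝ) ≤ m + 1))
  simp only [add_sub_cancel_left, norm_one, mul_one] at this
  refine le_trans (le_of_eq ?_) this
  congr 1
  simp only [hψ, hφ]
  rw [one_div, Complex.ofReal_inv, Complex.ofReal_add, Complex.ofReal_natCast, Complex.ofReal_one]
  ring

lemma tail_bound (t : ℝ) (ht : 0 < t) (X M : ℕ) (hX : 1 ≤ X) (hXM : X ≤ M) :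
    ‖∑ m ∈ Finset.Ioc X M, 1 / (m : ℂ) * Complex.exp (((t * Real.log m : ℝ) : ℂ) * Complex.I)‖
      ≤ (1 + t) / X + 2 / t := by
  have h : ‖∑ m ∈ Finset.Ioc X M, 1 / (m : ℂ) * Complex.exp (((t * Real.log m : ℝ) : ℂ) * Complex.I) -
      (Complex.exp (((t * Real.log ((M : ℝ) + 1) : ℝ) : ℂ) * Complex.I) / (t * Complex.I) -
        Complex.exp (((t * Real.log ((X : ℝ) + 1) : ℝ) : ℂ) * Complex.I) / (t * Complex.I))‖
      ≤ (1 + t) * (1 / X - 1 / M) := by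
    induction M, hXM using Nat.le_induction with
    | base => simp
    | succ M hM ih =>
      rw [← Finset.insert_Ioc_right_eq_Ioc_add_one hM, Finset.sum_insert (by simp)]
      have hM1 : (1 : ℝ) ≤ M := by exact_mod_cast hX.trans hM
      have hs := tail_step t ht (M + 1) (by omega)
      have h2 : (1 + t) / ((M + 1 : ℕ) : ℝ) ^ 2 ≤ (1 + t) * (1 / M - 1 / ((M + 1 : ℕ) : ℝ)) := by
        rw [div_eq_mul_one_div]
        refine mul_le_mul_of_nonneg_left ?_ (by linarith)
        push_cast
        rw [div_sub_div _ _ (by positivity) (by positivity), div_le_div_iff₀ (by positivity) (by positivity)]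
        nlinarith
      have := (norm_add_le _ _).trans (add_le_add (hs.trans h2) ih)
      refine le_trans (le_of_eq ?_) (this.trans (le_of_eq (by ring)))
      congr 1
      push_cast
      ring
  have hn : ∀ x : ℝ, ‖Complex.exp ((x : ℂ) * Complex.I) / (t * Complex.I)‖ = 1 / t := by
    intro x
    rw [norm_div, Complex.norm_exp_ofReal_mul_I, norm_mul, Complex.norm_I, Complex.norm_real, Real.norm_of_nonneg ht.le, mul_one]
  have h3 := norm_sub_le (Complex.exp (((t * Real.log ((M : ℝ) + 1) : ℝ) : ℂ) * Complex.I) / (t * Complex.I))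
        (Complex.exp (((t * Real.log ((X : ℝ) + 1) : ℝ) : ℂ) * Complex.I) / (t * Complex.I))
  rw [hn, hn] at h3
  have h4 : (1 + t) * (1 / X - 1 / M) ≤ (1 + t) / X := by
    have : (0 : ℝ) ≤ (1 + t) * (1 / M) := by positivity
    rw [mul_sub, mul_one_div]; linarith
  have h5 := norm_sub_norm_le (∑ m ∈ Finset.Ioc X M, 1 / (m : ℂ) * Complex.exp (((t * Real.log m : ℝ) : ℂ) * Complex.I))
    (Complex.exp (((t * Real.log ((M : ℝ) + 1) : ℝ) : ℂ) * Complex.I) / (t * Complex.I) -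
        Complex.exp (((t * Real.log ((X : ℝ) + 1) : ℝ) : ℂ) * Complex.I) / (t * Complex.I))
  have : 2 / t = 1 / t + 1 / t := by ring
  linarith

lemma Fm_split (d θ : ℝ) (hd : 0 < d) (m : ℕ) (hm : 1 ≤ m) (x : ℝ) (hx : 0 < x) :
    Fm d θ m x = Fm d θ 1 x + d * x * Real.log m := by
  have hm0 : (m : ℝ) ≠ 0 := by positivity
  unfold Fm
  have : Real.exp 1 * (m : ℝ) / (d * x) = (Real.exp 1 * ((1 : ℕ) : ℝ) / (d * x)) * m := by
    push_cast; ring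
  rw [this, Real.log_mul (by positivity) hm0]
  ring

lemma reduce (d θ : ℝ) (hd : 0 < d) (b : ℕ → ℂ) (M K X : ℕ) (hX : 1 ≤ X) :
    ∑ m ∈ Finset.Icc 1 M, b m * ∑ h ∈ Finset.Icc (-(K : ℤ)) K, ∫ x in (1 : ℝ)..(X : ℝ),
                Complex.exp (2 * (Real.pi : ℂ) * Complex.I *
                    ((Fm d θ m x - (h : ℝ) * x : ℝ) : ℂ)) / ((Real.sqrt x : ℝ) : ℂ)
    = ∫ x in (1 : ℝ)..(X : ℝ), Dk K x * (Complex.exp (((2 * Real.pi * Fm d θ 1 x : ℝ) : ℂ) * Complex.I) *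
      (∑ m ∈ Finset.Icc 1 M, b m * Complex.exp (((2 * Real.pi * d * x * Real.log m : ℝ) : ℂ) * Complex.I))
        / ((Real.sqrt x : ℝ) : ℂ)) := by
  have hX' : (1 : ℝ) ≤ X := by exact_mod_cast hX
  have hpos : ∀ u ∈ Set.uIcc (1:ℝ) X, 0 < u := by
    intro u hu; rw [Set.uIcc_of_le hX'] at hu; linarith [hu.1]
  have hci : ∀ m ∈ Finset.Icc 1 M, ∀ h : ℤ, IntervalIntegrable (fun x : ℝ => b m * (Complex.exp (2 * (Real.pi : ℂ) * Complex.I *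
                    ((Fm d θ m x - (h : ℝ) * x : ℝ) : ℂ)) / ((Real.sqrt x : ℝ) : ℂ))) MeasureTheory.volume 1 X := by
    intro m hm h
    have hm0 : (0 : ℝ) < m := by exact_mod_cast (Finset.mem_Icc.1 hm).1
    refine ContinuousOn.intervalIntegrable (ContinuousOn.mul (by fun_prop) ?_)
    refine ContinuousOn.div ?_ (by fun_prop) ?_
    · have : ContinuousOn (fun x : ℝ => Fm d θ m x - (h : ℝ) * x) (Set.uIcc (1:ℝ) X) := by
        unfold Fm
        refine ContinuousOn.sub (ContinuousOn.add (ContinuousOn.mul (by fun_prop) ?_) (by fun_prop)) (by fun_prop)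
        refine ContinuousOn.log (ContinuousOn.div (by fun_prop) (by fun_prop) ?_) ?_
        · intro u hu; have := hpos u hu; positivity
        · intro u hu; have := hpos u hu; positivity
      have := Complex.continuous_ofReal.comp_continuousOn this
      exact Complex.continuous_exp.comp_continuousOn (continuousOn_const.mul this)
    · intro u hu; exact_mod_cast (Real.sqrt_pos.2 (hpos u hu)).ne'
  simp_rw [Finset.mul_sum, ← intervalIntegral.integral_const_mul]
  rw [← show _ = _ from Finset.sum_congr rfl fun m hm => intervalIntegral.integral_finsetSum fun h _ => hci m hm h]
  rw [← intervalIntegral.integral_finsetSum]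
  · refine intervalIntegral.integral_congr ?_
    intro x hx
    have hx0 := hpos x hx
    simp only [Dk]
    rw [Finset.sum_div, Finset.sum_mul_sum, Finset.sum_comm]
    refine Finset.sum_congr rfl fun h _ => Finset.sum_congr rfl fun m hm => ?_
    rw [Fm_split d θ hd m (Finset.mem_Icc.1 hm).1 x hx0]
    have : Complex.exp (2 * (Real.pi : ℂ) * Complex.I * ((Fm d θ 1 x + d * x * Real.log m - (h : ℝ) * x : ℝ) : ℂ)) =
      Complex.exp (((-(2 * Real.pi * h * x) : ℝ) : ℂ) * Complex.I) *
      Complex.exp (((2 * Real.pi * Fm d θ 1 x : ℝ) : ℂ) * Complex.I) *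
      Complex.exp (((2 * Real.pi * d * x * Real.log m : ℝ) : ℂ) * Complex.I) := by
      rw [← Complex.exp_add, ← Complex.exp_add]
      congr 1
      push_cast
      ring
    rw [this]
    ring
  · intro m hm
    have := IntervalIntegrable.sum (Finset.Icc (-(K : ℤ)) K) (fun h _ => hci m hm h)
    simpa [Finset.sum_fn] using this

lemma approx (σ d : ℝ) (hσ : σ ≤ 0) (hd : 0 < d) : ∃ R Z : ℝ, 0 ≤ R ∧ 0 ≤ Z ∧ ∀ M X : ℕ, 1 ≤ X → X ≤ M →
    ∃ T T' : ℝ → ℂ, (∀ x, HasDerivAt T (T' x) x) ∧ Continuous T' ∧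
      (∀ u : ℝ, 1 ≤ u → u ≤ X → ‖∑ m ∈ Finset.Icc 1 M, (1 / ((((m : ℝ) ^ (1 - σ) : ℝ)) : ℂ)) *
        Complex.exp (((2 * Real.pi * d * u * Real.log m : ℝ) : ℂ) * Complex.I)‖ ≤ R + ‖T u‖) ∧
      ∫ u in (1:ℝ)..X, (‖T u‖ ^ 2 / Real.sqrt u + ‖T' u‖ ^ 2 / Real.sqrt u) ≤ Z * Real.sqrt X := by
  rcases hσ.lt_or_eq with hs | hs
  · have hsum : Summable (fun n : ℕ => (n : ℝ) ^ (-(1 - σ))) := Real.summable_nat_rpow.2 (by linarith)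
    refine ⟨∑' n : ℕ, (n : ℝ) ^ (-(1 - σ)), 0, by positivity, le_rfl, fun M X _ _ =>
      ⟨fun _ => 0, fun _ => 0, fun x => hasDerivAt_const _ _, continuous_const, ?_, by simp⟩⟩
    intro u _ _
    rw [norm_zero, add_zero]
    refine (norm_sum_le _ _).trans (le_trans (le_of_eq ?_) (hsum.sum_le_tsum (Finset.Icc 1 M) fun _ _ => by positivity))
    refine Finset.sum_congr rfl fun m _ => ?_
    rw [norm_mul, Complex.norm_exp_ofReal_mul_I, norm_div, Complex.norm_real, Real.norm_of_nonneg (by positivity),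
      Real.rpow_neg (by positivity)]
    simp
  · subst hs
    have hτ : 0 < 2 * Real.pi * d := by have := Real.pi_pos; positivity
    set τ := 2 * Real.pi * d with hτd
    obtain ⟨Z, hZ0, hZ⟩ := meansq_final τ hτ (1 + τ) (by linarith)
    refine ⟨1 + τ + 2 / τ, 2 * Z, by positivity, by positivity, fun M X hX hXM => ?_⟩
    have hX' : (1 : ℝ) ≤ X := by exact_mod_cast hX
    refine ⟨fun u => ∑ m ∈ Finset.Icc 1 X, 1 / (m : ℂ) * Complex.exp (((τ * u * Real.log m : ℝ) : ℂ) * Complex.I),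
      fun u => ∑ m ∈ Finset.Icc 1 X, (1 / (m : ℂ) * ((τ * Real.log m : ℝ) * Complex.I)) * Complex.exp (((τ * u * Real.log m : ℝ) : ℂ) * Complex.I),
      ?_, by fun_prop, ?_, ?_⟩
    · intro x
      refine HasDerivAt.fun_sum fun m _ => ?_
      have h1 : HasDerivAt (fun u : ℝ => τ * u * Real.log m) (τ * Real.log m) x := by
        simpa using ((hasDerivAt_id x).const_mul τ).mul_const (Real.log m)
      have := ((h1.ofReal_comp.mul_const Complex.I).cexp).const_mul (1 / (m : ℂ))
      refine this.congr_deriv ?_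
      ring
    · intro u hu1 hu2
      have e : ∑ m ∈ Finset.Icc 1 M, (1 / ((((m : ℝ) ^ (1 - (0:ℝ)) : ℝ)) : ℂ)) *
          Complex.exp (((τ * u * Real.log m : ℝ) : ℂ) * Complex.I) =
          ∑ m ∈ Finset.Icc 1 X, 1 / (m : ℂ) * Complex.exp (((τ * u * Real.log m : ℝ) : ℂ) * Complex.I) +
          ∑ m ∈ Finset.Ioc X M, 1 / (m : ℂ) * Complex.exp (((τ * u * Real.log m : ℝ) : ℂ) * Complex.I) := by
        rw [← Finset.sum_union]
        · refine Finset.sum_congr ?_ fun m _ => ?_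
          · ext m; simp only [Finset.mem_Icc, Finset.mem_Ioc, Finset.mem_union]; omega
          · rw [sub_zero, Real.rpow_one, Complex.ofReal_natCast]
        · rw [Finset.disjoint_left]; intro m h1 h2
          simp only [Finset.mem_Icc, Finset.mem_Ioc] at h1 h2; omega
      rw [e]
      have ht : 0 < τ * u := by positivity
      have h1 := tail_bound (τ * u) ht X M hX hXM
      have h2 : (1 + τ * u) / X ≤ 1 + τ := by
        rw [div_le_iff₀ (by linarith)]
        nlinarith
      have h3 : 2 / (τ * u) ≤ 2 / τ := by
        gcongr
        nlinarith
      refine (norm_add_le _ _).trans ?_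
      linarith
    · have hc : ∀ g : ℝ → ℂ, Continuous g → IntervalIntegrable (fun u => ‖g u‖ ^ 2 / Real.sqrt u) MeasureTheory.volume 1 X := by
        intro g hg
        refine ContinuousOn.intervalIntegrable ?_
        refine ContinuousOn.div (by fun_prop) (by fun_prop) ?_
        intro u hu
        rw [Set.uIcc_of_le hX'] at hu
        exact (Real.sqrt_pos.2 (by linarith [hu.1])).ne'
      rw [intervalIntegral.integral_add (hc _ (by fun_prop)) (hc _ (by fun_prop))]
      have a1 := hZ X hX (fun m => 1 / (m : ℂ)) (by
        intro m hm
        have hl := Real.log_natCast_nonneg m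
        have hm0 : (0 : ℝ) < m := by exact_mod_cast hm
        rw [norm_div, norm_one, Complex.norm_natCast, ← mul_div_assoc]
        gcongr
        nlinarith)
      have a2 := hZ X hX (fun m => (1 / (m : ℂ) * ((τ * Real.log m : ℝ) * Complex.I))) (by
        intro m hm
        have hl := Real.log_natCast_nonneg m
        have hm0 : (0 : ℝ) < m := by exact_mod_cast hm
        rw [norm_mul, norm_div, norm_one, Complex.norm_natCast, norm_mul, Complex.norm_I, Complex.norm_real,
          Real.norm_of_nonneg (by positivity), ← mul_div_assoc, mul_one, one_div_mul_eq_div]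
        refine div_le_div_of_nonneg_right ?_ hm0.le
        nlinarith)
      linarith

lemma main_bound (σ d θ : ℝ) (hσ : σ ≤ 0) (hd : 0 < d) : ∃ C : ℝ, 0 ≤ C ∧ ∀ M X K : ℕ, 1 ≤ X → X ≤ M →
    ‖∑ m ∈ Finset.Icc 1 M, (1 / ((((m : ℝ) ^ (1 - σ) : ℝ)) : ℂ)) *
      ∑ h ∈ Finset.Icc (-(K : ℤ)) K, ∫ x in (1 : ℝ)..(X : ℝ),
                Complex.exp (2 * (Real.pi : ℂ) * Complex.I *
                    ((Fm d θ m x - (h : ℝ) * x : ℝ) : ℂ)) / ((Real.sqrt x : ℝ) : ℂ)‖ ≤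
      C * (Real.sqrt X * Real.log (4 * K + 3)) := by
  obtain ⟨R, Z, hR, hZ, hap⟩ := approx σ d hσ hd
  refine ⟨4 * ((R + 2) * 2 + Z), by positivity, fun M X K hX hXM => ?_⟩
  obtain ⟨T, T', hT, hT', hST, hint⟩ := hap M X hX hXM
  have hX' : (1 : ℝ) ≤ X := by exact_mod_cast hX
  have hTc : Continuous T := continuous_iff_continuousAt.2 fun x => (hT x).continuousAt
  rw [reduce d θ hd _ M K X hX]
  refine (intervalIntegral.norm_integral_le_integral_norm hX').trans ?_
  have hw := weighted K X hX (fun u => ∑ m ∈ Finset.Icc 1 M, (1 / ((((m : ℝ) ^ (1 - σ) : ℝ)) : ℂ)) *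
        Complex.exp (((2 * Real.pi * d * u * Real.log m : ℝ) : ℂ) * Complex.I)) T T' (by fun_prop) hT hT' R hR hST
  have e : ∀ x : ℝ, ‖Dk K x * (Complex.exp (((2 * Real.pi * Fm d θ 1 x : ℝ) : ℂ) * Complex.I) *
      (∑ m ∈ Finset.Icc 1 M, (1 / ((((m : ℝ) ^ (1 - σ) : ℝ)) : ℂ)) * Complex.exp (((2 * Real.pi * d * x * Real.log m : ℝ) : ℂ) * Complex.I))
        / ((Real.sqrt x : ℝ) : ℂ))‖ = ‖Dk K x‖ * (‖∑ m ∈ Finset.Icc 1 M, (1 / ((((m : ℝ) ^ (1 - σ) : ℝ)) : ℂ)) *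
        Complex.exp (((2 * Real.pi * d * x * Real.log m : ℝ) : ℂ) * Complex.I)‖ / Real.sqrt x) := by
    intro x
    rw [norm_mul, norm_div, norm_mul, Complex.norm_exp_ofReal_mul_I, one_mul, Complex.norm_real,
      Real.norm_of_nonneg (Real.sqrt_nonneg x)]
  simp_rw [e]
  refine hw.trans ?_
  have hci : ∀ g : ℝ → ℝ, Continuous g → IntervalIntegrable (fun u => g u / Real.sqrt u) MeasureTheory.volume 1 X := by
    intro g hg
    refine ContinuousOn.intervalIntegrable ?_
    refine ContinuousOn.div (by fun_prop) (by fun_prop) ?_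
    intro u hu
    rw [Set.uIcc_of_le hX'] at hu
    exact (Real.sqrt_pos.2 (by linarith [hu.1])).ne'
  have i1 := hci (fun _ => 1) continuous_const
  have i2 := (hci (fun u => ‖T u‖ ^ 2) (by fun_prop)).add (hci (fun u => ‖T' u‖ ^ 2) (by fun_prop))
  have hlast : ∫ u in (1:ℝ)..X, (R + ‖T u‖ + ‖T' u‖) / Real.sqrt u ≤ ((R + 2) * 2 + Z) * Real.sqrt X := by
    calc _ ≤ ∫ u in (1:ℝ)..X, ((R + 2) * (1 / Real.sqrt u) + (‖T u‖ ^ 2 / Real.sqrt u + ‖T' u‖ ^ 2 / Real.sqrt u)) := by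
          refine intervalIntegral.integral_mono_on hX' (hci _ (by fun_prop)) ((i1.const_mul _).add i2) ?_
          intro u hu
          have : (R + 2) * (1 / Real.sqrt u) + (‖T u‖ ^ 2 / Real.sqrt u + ‖T' u‖ ^ 2 / Real.sqrt u) =
            (R + 2 + ‖T u‖ ^ 2 + ‖T' u‖ ^ 2) / Real.sqrt u := by ring
          rw [this]
          refine div_le_div_of_nonneg_right ?_ (Real.sqrt_nonneg u)
          nlinarith [sq_nonneg (‖T u‖ - 1), sq_nonneg (‖T' u‖ - 1)]
      _ = (R + 2) * (∫ u in (1:ℝ)..X, 1 / Real.sqrt u) + ∫ u in (1:ℝ)..X, (‖T u‖ ^ 2 / Real.sqrt u + ‖T' u‖ ^ 2 / Real.sqrt u) := by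
          rw [← intervalIntegral.integral_const_mul]
          exact intervalIntegral.integral_add (i1.const_mul _) i2
      _ ≤ (R + 2) * (2 * Real.sqrt X) + Z * Real.sqrt X :=
          add_le_add (mul_le_mul_of_nonneg_left (int_sqrt X hX') (by linarith)) hint
      _ = _ := by ring
  have hlog := Real.log_nonneg (x := 4 * (K:ℝ) + 3) (by linarith [Nat.cast_nonneg (α := ℝ) K])
  refine (mul_le_mul_of_nonneg_left hlast (by positivity)).trans (le_of_eq (by ring))

theorem statement13 (σ d θ : ℝ) (hσ : σ ≤ 0) (hd : 0 < d)
    (α : ℝ) (hα0 : 0 < α) (hα1 : α ≤ 1) (C1 C2 : ℝ) (hC1 : 1 < C1) (hC12 : C1 < C2) :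
    ∃ c > (0 : ℝ), ∃ C > (0 : ℝ), ∀ M N : ℕ, 0 < M → 0 < N →
      C1 * N ≤ M → (M : ℝ) ≤ C2 * N →
      ∀ X : ℕ, 2 ≤ X → X ≤ M → X ≤ N →
        ‖∑ m ∈ Finset.Icc 1 M, (1 / ((((m : ℝ) ^ (1 - σ) : ℝ)) : ℂ)) *
            ∑ h ∈ Finset.Icc (-⌊c * (Real.log ((M : ℝ) * N)) ^ (1 + α)⌋)
                ⌊c * (Real.log ((M : ℝ) * N)) ^ (1 + α)⌋,
              ∫ x in (1 : ℝ)..(X : ℝ),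
                Complex.exp (2 * (Real.pi : ℂ) * Complex.I *
                    ((Fm d θ m x - (h : ℝ) * x : ℝ) : ℂ)) / ((Real.sqrt x : ℝ) : ℂ)‖
          ≤ C * (if σ = 0 then
                Real.sqrt X * (Real.log X) ^ ((2 : ℝ) / 3) *
                  Real.log (c * (Real.log ((M : ℝ) * N)) ^ (1 + α))
              else Real.sqrt X * Real.log (c * (Real.log ((M : ℝ) * N)) ^ (1 + α))) := by
  obtain ⟨C, hC, hmain⟩ := main_bound σ d θ hσ hd
  refine ⟨3, by norm_num, 6 * C + 1, by positivity, ?_⟩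
  intro M N hM hN h1 h2 X hX2 hXM hXN
  set H : ℝ := 3 * (Real.log ((M : ℝ) * N)) ^ (1 + α) with hH
  have hN2 : (2 : ℝ) ≤ N := by exact_mod_cast hX2.trans hXN
  have hM2 : (2 : ℝ) ≤ M := by exact_mod_cast hX2.trans hXM
  have hlog1 : 1 ≤ Real.log ((M : ℝ) * N) := by
    rw [Real.le_log_iff_exp_le (by positivity)]
    have := Real.exp_one_lt_d9
    nlinarith
  have hH3 : 3 ≤ H := by
    have := Real.one_le_rpow hlog1 (by linarith : 0 ≤ 1 + α)
    rw [hH]; linarith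
  obtain ⟨K, hK⟩ := Int.eq_ofNat_of_zero_le (Int.floor_nonneg.2 (by linarith : 0 ≤ H))
  have hKH : (K : ℝ) ≤ H := by
    have := Int.floor_le H
    rw [hK] at this
    exact_mod_cast this
  rw [hK]
  have hb := hmain M X K (by omega) hXM
  have hlogH : 0 < Real.log H := Real.log_pos (by linarith)
  have hlK : Real.log (4 * K + 3) ≤ 3 * Real.log H := by
    rw [show 3 * Real.log H = Real.log (H ^ 3) by rw [Real.log_pow]; norm_num]
    refine Real.log_le_log (by positivity) ?_
    nlinarith [mul_le_mul hH3 hH3 (by norm_num) (by linarith)]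
  have hb2 : C * (Real.sqrt X * Real.log (4 * K + 3)) ≤ 3 * C * (Real.sqrt X * Real.log H) := by
    have := mul_le_mul_of_nonneg_left (mul_le_mul_of_nonneg_left hlK (Real.sqrt_nonneg X)) hC
    linarith
  refine (hb.trans hb2).trans ?_
  have hP : 0 ≤ Real.sqrt X * Real.log H := by positivity
  have hCP : 0 ≤ C * (Real.sqrt X * Real.log H) := by positivity
  split_ifs with hs
  · have hl2 : Real.log 2 ≤ Real.log X := Real.log_le_log (by norm_num) (by exact_mod_cast hX2)
    have hl2' := Real.log_two_gt_d9
    have hl2'' := Real.log_two_lt_d9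
    have hr : 1 / 2 ≤ (Real.log X) ^ ((2 : ℝ) / 3) := by
      calc (1 / 2 : ℝ) ≤ Real.log 2 := by linarith
        _ = Real.log 2 ^ (1 : ℝ) := (Real.rpow_one _).symm
        _ ≤ Real.log 2 ^ ((2 : ℝ) / 3) :=
            Real.rpow_le_rpow_of_exponent_ge (by linarith) (by linarith) (by norm_num)
        _ ≤ _ := Real.rpow_le_rpow (by linarith) hl2 (by norm_num)
    have : Real.sqrt X * Real.log H * (1 / 2) ≤ Real.sqrt X * Real.log H * (Real.log X) ^ ((2 : ℝ) / 3) :=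
      mul_le_mul_of_nonneg_left hr hP
    calc 3 * C * (Real.sqrt X * Real.log H) ≤ (6 * C + 1) * (Real.sqrt X * Real.log H * (1 / 2)) := by nlinarith
      _ ≤ (6 * C + 1) * (Real.sqrt X * Real.log H * (Real.log X) ^ ((2 : ℝ) / 3)) :=
          mul_le_mul_of_nonneg_left this (by positivity)
      _ = _ := by ring
  · nlinarith
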